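/- arXiv:2110.02348 — 3 statements merged into one kernel-verified Lean document; each statement's English description precedes it below -/
import Mathlib

section
/- Let α₁, α₂, α₃ > 0 with α₂ ≤ α₃ ≤ α₁ and let s₁, t₁, s₂₁, s₂₂, t₂ ∈ ℝ satisfy s₁² + t₁² = 1, s₁ > 0, t₁ > 0, α₂s₁ ≤ α₁/2, s₂₁² + s₂₂² + t₂² = 1, t₂ > 0, α₃s₂₁ ≤ α₁/2. Let T ⊂ ℝ³ be the tetrahedron with vertices x₁ = (0,0,0), x₂ = (α₁,0,0), x₄ = (α₃s₂₁, α₃s₂₂, α₃t₂), and either x₃ = (α₂s₁, α₂t₁, 0) (type i) or x₃ = (α₁ − α₂s₁, α₂t₁, 0) (type ii). Assume (Condition 2) that α₂ = |x₁ − x₃| (type i) or α₂ = |x₂ − x₃| (type ii) is the minimal edge length of T and α₁ = |x₁ − x₂| is the maximal length among the edges of T sharing an endpoint with that minimal edge; set h_T := diam(T). Let A₀ ∈ O(3), b ∈ ℝ³, and T₀ := {A₀x + b : x ∈ T}. Then (1/2)·H_{T₀} < H_T < 2·H_{T₀}, where H_T := (α₁α₂α₃/|T|)·h_T and H_{T₀}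 := (h_{T₀}²/|T₀|)·min_{i≠j}|L_i||L_j|, with h_{T₀} := diam(T₀), |T| and |T₀| the three-dimensional Lebesgue measures, and L₁,…,L₆ the six edges of T₀. -/
open MeasureTheory

noncomputable section

/-- In a strictly convex space the triangle inequality is strict for affinely independent points. -/
theorem AffineIndependent.dist_lt_dist_add_dist {ι V P : Type*} [NormedAddCommGroup V]
    [NormedSpace ℝ V] [StrictConvexSpace ℝ V] [MetricSpace P] [NormedAddTorsor V P]
    {p : ι → P} (hp : AffineIndependent ℝ p) {i j k : ι} (hij : i ≠ j) (hjk : j ≠ k) :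
    dist (p i) (p k) < dist (p i) (p j) + dist (p j) (p k) := by
  rw [dist_lt_dist_add_dist_iff]
  intro h
  have hmem := h.mem_affineSpan
  rw [← Set.image_pair, hp.mem_affineSpan_iff] at hmem
  rcases hmem with h | h
  · exact hij h.symm
  · exact hjk h

/-- The rigid motion `x ↦ A x + b` with `A` orthogonal, as a volume-preserving affine isometry. -/
theorem exists_affineMap_isometry_of_mem_orthogonalGroup {n : Type*} [Fintype n] [DecidableEq n]
    {A : Matrix n n ℝ} (hA : A ∈ Matrix.orthogonalGroup n ℝ) (b : EuclideanSpace ℝ n) :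
    ∃ g : EuclideanSpace ℝ n →ᵃ[ℝ] EuclideanSpace ℝ n, Isometry g ∧
      (∀ s, volume (g '' s) = volume s) ∧ ∀ x i, g x i = A.mulVec x i + b i := by
  have hnorm : ∀ x, ‖Matrix.toEuclideanLin A x‖ = ‖x‖ := by
    intro x
    have h : inner ℝ (Matrix.toEuclideanLin A x) (Matrix.toEuclideanLin A x) = inner ℝ x x := by
      simp only [EuclideanSpace.inner_eq_star_dotProduct, star_trivial, Matrix.ofLp_toLpLin,
        Matrix.toLin'_apply]
      rw [Matrix.dotProduct_mulVec, Matrix.vecMul_mulVec, ← Matrix.dotProduct_mulVec,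
        (Matrix.mem_orthogonalGroup_iff' n ℝ).mp hA, Matrix.one_mulVec]
    rw [real_inner_self_eq_norm_sq, real_inner_self_eq_norm_sq] at h
    exact (sq_eq_sq₀ (norm_nonneg _) (norm_nonneg _)).mp h
  let f : EuclideanSpace ℝ n →ₗᵢ[ℝ] EuclideanSpace ℝ n := ⟨Matrix.toEuclideanLin A, hnorm⟩
  let e := f.toLinearIsometryEquiv rfl
  refine ⟨f.toLinearMap.toAffineMap + AffineMap.const ℝ (EuclideanSpace ℝ n) b, ?_, ?_,
    fun x i => rfl⟩
  · exact (IsometryEquiv.addRight b).isometry.comp f.isometry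
  · intro s
    have himage : (f.toLinearMap.toAffineMap + AffineMap.const ℝ (EuclideanSpace ℝ n) b) '' s =
        (fun x => x + b) '' (e '' s) := by
      rw [Set.image_image]
      rfl
    rw [himage, Set.image_add_right, measure_preimage_add_right,
      LinearIsometryEquiv.image_eq_preimage_symm]
    exact e.symm.measurePreserving.measure_preimage_equiv (f := e.symm.toMeasurableEquiv) s

/-- A tetrahedron with vertices `0`, `(p, 0, 0)`, `(q, r, 0)`, `(u, v, w)`, where `p`, `r`, `w` are
nonzero, is nondegenerate. -/
theorem affineSpan_eq_top_of_triangular {x₂ x₃ x₄ : EuclideanSpace ℝ (Fin 3)}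
    (h₂ : x₂ 0 ≠ 0) (h₂₁ : x₂ 1 = 0) (h₂₂ : x₂ 2 = 0) (h₃ : x₃ 1 ≠ 0) (h₃₂ : x₃ 2 = 0)
    (h₄ : x₄ 2 ≠ 0) :
    affineSpan ℝ ({0, x₂, x₃, x₄} : Set (EuclideanSpace ℝ (Fin 3))) = ⊤ := by
  rw [← AffineSubspace.coe_eq_univ_iff, affineSpan_insert_zero, Set.eq_univ_iff_forall]
  intro v
  rw [SetLike.mem_coe, Submodule.mem_span_triple]
  refine ⟨(v 0 - v 2 / x₄ 2 * x₄ 0 - (v 1 - v 2 / x₄ 2 * x₄ 1) / x₃ 1 * x₃ 0) / x₂ 0,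
    (v 1 - v 2 / x₄ 2 * x₄ 1) / x₃ 1, v 2 / x₄ 2, ?_⟩
  ext i
  fin_cases i
  · simp [h₂]
  · simp [h₂₁, h₃]
  · simp [h₂₂, h₃₂, h₄]

theorem affineIndependent_of_affineSpan_eq_top {x₁ x₂ x₃ x₄ : EuclideanSpace ℝ (Fin 3)}
    (h : affineSpan ℝ {x₁, x₂, x₃, x₄} = ⊤) : AffineIndependent ℝ ![x₁, x₂, x₃, x₄] := by
  have hrange : Set.range ![x₁, x₂, x₃, x₄] = {x₁, x₂, x₃, x₄} := by
    simp only [Matrix.range_cons, Matrix.range_empty, Set.union_empty, Set.singleton_union]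
  rw [affineIndependent_iff_finrank_vectorSpan_eq (n := 3) ℝ _ (by simp), hrange,
    ← direction_affineSpan, h, AffineSubspace.direction_top, finrank_top,
    finrank_euclideanSpace_fin]

theorem Set.Finite.volume_convexHull_toReal_pos {E : Type*} [NormedAddCommGroup E]
    [NormedSpace ℝ E] [FiniteDimensional ℝ E] [MeasureSpace E] [BorelSpace E]
    [(volume : Measure E).IsOpenPosMeasure] [IsFiniteMeasureOnCompacts (volume : Measure E)]
    {s : Set E} (hs : s.Finite) (h : affineSpan ℝ s = ⊤) :
    0 < (volume (convexHull ℝ s)).toReal :=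
  ENNReal.toReal_pos
    (Measure.measure_pos_of_nonempty_interior _
      (interior_convexHull_nonempty_iff_affineSpan_eq_top.mpr h)).ne'
    (hs.isCompact_convexHull ℝ).measure_lt_top.ne

/-- If `a = L k₀` is the least value of `L` and `c = L k₁` is less than twice every value at an
index other than `k₀`, then the least product of two values is comparable to `a * c`. -/
theorem inf'_mul_bounds {ι : Type*} [Fintype ι] [DecidableEq ι] {L : ι → ℝ} {k₀ k₁ : ι}
    (hk : k₀ ≠ k₁) {a c : ℝ} (ha : 0 < a) (h₀ : L k₀ = a) (h₁ : L k₁ = c)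
    (hle : ∀ k, a ≤ L k) (hlt : ∀ k, k ≠ k₀ → c < 2 * L k)
    (hne : (Finset.univ.filter (fun q : ι × ι => q.1 ≠ q.2)).Nonempty) :
    (Finset.univ.filter (fun q : ι × ι => q.1 ≠ q.2)).inf' hne (fun q => L q.1 * L q.2) ≤ a * c ∧
    a * c <
      2 * (Finset.univ.filter (fun q : ι × ι => q.1 ≠ q.2)).inf' hne (fun q => L q.1 * L q.2) := by
  constructor
  · have h := Finset.inf'_le (s := Finset.univ.filter (fun q : ι × ι => q.1 ≠ q.2))
      (fun q => L q.1 * L q.2) (b := (k₀, k₁)) (by simpa using hk)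
    simpa only [h₀, h₁] using h
  · rw [← div_lt_iff₀' two_pos, Finset.lt_inf'_iff]
    rintro ⟨i, j⟩ hij
    replace hij : i ≠ j := by simpa using hij
    have hi := hle i
    have hj := hle j
    by_cases h : i = k₀
    · have := hlt j (h ▸ hij.symm)
      dsimp only
      nlinarith
    · have := hlt i h
      dsimp only
      nlinarith

theorem diam_four_lt {X : Type*} [PseudoMetricSpace X] {x₁ x₂ x₃ x₄ : X} {r : ℝ} (hr : 0 < r)
    (h₁₂ : dist x₁ x₂ < r) (h₁₃ : dist x₁ x₃ < r) (h₁₄ : dist x₁ x₄ < r) (h₂₃ : dist x₂ x₃ < r)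
    (h₂₄ : dist x₂ x₄ < r) (h₃₄ : dist x₃ x₄ < r) :
    Metric.diam {x₁, x₂, x₃, x₄} < r := by
  have hfin : ({x₁, x₂, x₃, x₄} : Set X).Finite := by simp
  obtain ⟨x, hx, y, hy, hxy⟩ : ∃ x ∈ ({x₁, x₂, x₃, x₄} : Set X),
      ∃ y ∈ ({x₁, x₂, x₃, x₄} : Set X), Metric.diam {x₁, x₂, x₃, x₄} ≤ dist x y := by
    obtain ⟨⟨x, y⟩, hxy, hmax⟩ := Set.exists_max_image _ (fun q : X × X => dist q.1 q.2)
      (hfin.prod hfin) ⟨(x₁, x₁), by simp⟩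
    exact ⟨x, hxy.1, y, hxy.2,
      Metric.diam_le_of_forall_dist_le dist_nonneg fun u hu v hv => hmax (u, v) ⟨hu, hv⟩⟩
  refine hxy.trans_lt ?_
  simp only [Set.mem_insert_iff, Set.mem_singleton_iff] at hx hy
  rcases hx with rfl | rfl | rfl | rfl <;> rcases hy with rfl | rfl | rfl | rfl <;>
    first | simpa using hr | assumption | (rw [dist_comm]; assumption)

/-- Equivalence of the geometric parameters `H_T` and `H_{T₀}` for tetrahedra
(`(1/2)·H_{T₀} < H_T < 2·H_{T₀}`). -/
theorem stmt_1
    (α₁ α₂ α₃ s₁ t₁ s₂₁ s₂₂ t₂ : ℝ)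
    (hα₂pos : 0 < α₂) (hα₂₃ : α₂ ≤ α₃) (hα₃₁ : α₃ ≤ α₁)
    (hs₁t₁ : s₁ ^ 2 + t₁ ^ 2 = 1) (hs₁ : 0 < s₁) (ht₁ : 0 < t₁)
    (hshort₁ : α₂ * s₁ ≤ α₁ / 2)
    (hs₂t₂ : s₂₁ ^ 2 + s₂₂ ^ 2 + t₂ ^ 2 = 1) (ht₂ : 0 < t₂)
    (hshort₂ : α₃ * s₂₁ ≤ α₁ / 2)
    (x₁ x₂ x₃ x₄ : EuclideanSpace ℝ (Fin 3))
    (hx₁ : x₁ = 0)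
    (hx₂ : ∀ j : Fin 3, x₂ j = if (j : ℕ) = 0 then α₁ else 0)
    (hx₄ : ∀ j : Fin 3, x₄ j =
      if (j : ℕ) = 0 then α₃ * s₂₁ else if (j : ℕ) = 1 then α₃ * s₂₂ else α₃ * t₂)
    (T : Set (EuclideanSpace ℝ (Fin 3)))
    (hT : T = convexHull ℝ {x₁, x₂, x₃, x₄})
    -- Condition 2, in the two cases (type i) and (type ii):
    (hcond :
      -- type i: x₃ = (α₂s₁, α₂t₁, 0), the minimal edge is x₁x₃,
      -- and x₁x₂ is longest among the edges sharing an endpoint with x₁x₃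
      ((∀ j : Fin 3, x₃ j = if (j : ℕ) = 0 then α₂ * s₁ else if (j : ℕ) = 1 then α₂ * t₁ else 0) ∧
        α₂ = dist x₁ x₃ ∧
        dist x₁ x₃ ≤ dist x₁ x₂ ∧ dist x₁ x₃ ≤ dist x₁ x₄ ∧ dist x₁ x₃ ≤ dist x₂ x₃ ∧
        dist x₁ x₃ ≤ dist x₂ x₄ ∧ dist x₁ x₃ ≤ dist x₃ x₄ ∧
        α₁ = dist x₁ x₂ ∧
        dist x₁ x₄ ≤ dist x₁ x₂ ∧ dist x₂ x₃ ≤ dist x₁ x₂ ∧ dist x₃ x₄ ≤ dist x₁ x₂) ∨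
      -- type ii: x₃ = (α₁ − α₂s₁, α₂t₁, 0), the minimal edge is x₂x₃,
      -- and x₁x₂ is longest among the edges sharing an endpoint with x₂x₃
      ((∀ j : Fin 3, x₃ j =
          if (j : ℕ) = 0 then α₁ - α₂ * s₁ else if (j : ℕ) = 1 then α₂ * t₁ else 0) ∧
        α₂ = dist x₂ x₃ ∧
        dist x₂ x₃ ≤ dist x₁ x₂ ∧ dist x₂ x₃ ≤ dist x₁ x₃ ∧ dist x₂ x₃ ≤ dist x₁ x₄ ∧
        dist x₂ x₃ ≤ dist x₂ x₄ ∧ dist x₂ x₃ ≤ dist x₃ x₄ ∧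
        α₁ = dist x₁ x₂ ∧
        dist x₂ x₄ ≤ dist x₁ x₂ ∧ dist x₁ x₃ ≤ dist x₁ x₂ ∧ dist x₃ x₄ ≤ dist x₁ x₂))
    (A₀ : Matrix (Fin 3) (Fin 3) ℝ) (hA₀ : A₀ ∈ Matrix.orthogonalGroup (Fin 3) ℝ)
    (b : EuclideanSpace ℝ (Fin 3))
    (y₁ y₂ y₃ y₄ : EuclideanSpace ℝ (Fin 3))
    (hy₁ : ∀ i, y₁ i = A₀.mulVec x₁ i + b i)
    (hy₂ : ∀ i, y₂ i = A₀.mulVec x₂ i + b i)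
    (hy₃ : ∀ i, y₃ i = A₀.mulVec x₃ i + b i)
    (hy₄ : ∀ i, y₄ i = A₀.mulVec x₄ i + b i)
    (T₀ : Set (EuclideanSpace ℝ (Fin 3)))
    (hT₀ : T₀ = convexHull ℝ {y₁, y₂, y₃, y₄})
    -- the six edge lengths of T₀
    (L : Fin 6 → ℝ)
    (hL : L = ![dist y₁ y₂, dist y₁ y₃, dist y₁ y₄, dist y₂ y₃, dist y₂ y₄, dist y₃ y₄]) :
    (1 / 2) * ((Metric.diam T₀) ^ 2 / (volume T₀).toReal *
        (Finset.univ.filter (fun q : Fin 6 × Fin 6 => q.1 ≠ q.2)).inf'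
          (by decide) (fun q => L q.1 * L q.2))
      < α₁ * α₂ * α₃ / (volume T).toReal * Metric.diam T ∧
    α₁ * α₂ * α₃ / (volume T).toReal * Metric.diam T
      < 2 * ((Metric.diam T₀) ^ 2 / (volume T₀).toReal *
        (Finset.univ.filter (fun q : Fin 6 × Fin 6 => q.1 ≠ q.2)).inf'
          (by decide) (fun q => L q.1 * L q.2)) := by
  obtain ⟨g, hg, hvol, hgx⟩ := exists_affineMap_isometry_of_mem_orthogonalGroup hA₀ b
  obtain rfl : y₁ = g x₁ := by ext i; rw [hy₁, hgx]
  obtain rfl : y₂ = g x₂ := by ext i; rw [hy₂, hgx]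
  obtain rfl : y₃ = g x₃ := by ext i; rw [hy₃, hgx]
  obtain rfl : y₄ = g x₄ := by ext i; rw [hy₄, hgx]
  obtain rfl : T₀ = g '' T := by
    rw [hT₀, hT, AffineMap.image_convexHull]
    simp only [Set.image_insert_eq, Set.image_singleton]
  rw [hvol, hg.diam_image]
  simp only [hg.dist_eq] at hL
  have hα₃pos : 0 < α₃ := hα₂pos.trans_le hα₂₃
  have hα₁pos : 0 < α₁ := hα₃pos.trans_le hα₃₁
  have hx₃ : x₃ 1 ≠ 0 ∧ x₃ 2 = 0 := by
    rcases hcond with ⟨h, -⟩ | ⟨h, -⟩ <;> simp [h, hα₂pos.ne', ht₁.ne']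
  have hspan : affineSpan ℝ {x₁, x₂, x₃, x₄} = ⊤ := by
    rw [hx₁]
    exact affineSpan_eq_top_of_triangular (by simp [hx₂, hα₁pos.ne']) (by simp [hx₂])
      (by simp [hx₂]) hx₃.1 hx₃.2 (by simp [hx₄, hα₃pos.ne', ht₂.ne'])
  have hind := affineIndependent_of_affineSpan_eq_top hspan
  have hV : 0 < (volume T).toReal := by
    rw [hT]
    exact Set.Finite.volume_convexHull_toReal_pos (by simp) hspan
  have hD : Metric.diam T = Metric.diam {x₁, x₂, x₃, x₄} := by rw [hT, convexHull_diam]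
  have h₁₄ : dist x₁ x₄ = α₃ := by
    rw [← sq_eq_sq₀ dist_nonneg hα₃pos.le, EuclideanSpace.dist_sq_eq, Fin.sum_univ_three]
    simp only [Real.dist_eq, sq_abs, hx₁, hx₄]
    simp
    linear_combination α₃ ^ 2 * hs₂t₂
  have h₂₄ : α₃ ≤ dist x₂ x₄ := by
    rw [← sq_le_sq₀ hα₃pos.le dist_nonneg, EuclideanSpace.dist_sq_eq, Fin.sum_univ_three]
    simp only [Real.dist_eq, sq_abs, hx₂, hx₄]
    simp
    linear_combination -α₃ ^ 2 * hs₂t₂ + 2 * α₁ * hshort₂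
  have t₁₃₂ : dist x₁ x₂ < dist x₁ x₃ + dist x₃ x₂ :=
    hind.dist_lt_dist_add_dist (i := 0) (j := 2) (k := 1) (by decide) (by decide)
  have t₁₃₄ : dist x₁ x₄ < dist x₁ x₃ + dist x₃ x₄ :=
    hind.dist_lt_dist_add_dist (i := 0) (j := 2) (k := 3) (by decide) (by decide)
  have t₂₁₄ : dist x₂ x₄ < dist x₂ x₁ + dist x₁ x₄ :=
    hind.dist_lt_dist_add_dist (i := 1) (j := 0) (k := 3) (by decide) (by decide)
  have t₂₃₄ : dist x₂ x₄ < dist x₂ x₃ + dist x₃ x₄ :=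
    hind.dist_lt_dist_add_dist (i := 1) (j := 2) (k := 3) (by decide) (by decide)
  rw [dist_comm x₃ x₂] at t₁₃₂
  rw [dist_comm x₂ x₁] at t₂₁₄
  have hα₁D : dist x₁ x₂ ≤ Metric.diam T :=
    hD ▸ Metric.dist_le_diam_of_mem (Set.Finite.isBounded (by simp)) (by simp) (by simp)
  have hD_lt : Metric.diam T < 2 * α₁ := by
    rw [hD]
    rcases hcond with ⟨-, h⟩ | ⟨-, h⟩ <;> apply diam_four_lt <;> linarith
  have hα₁ : α₁ = dist x₁ x₂ := by
    rcases hcond with h | h <;> exact h.2.2.2.2.2.2.2.1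
  set m := (Finset.univ.filter (fun q : Fin 6 × Fin 6 => q.1 ≠ q.2)).inf'
    (by decide) (fun q => L q.1 * L q.2)
  obtain ⟨hm_le, hm_lt⟩ : m ≤ α₂ * α₃ ∧ α₂ * α₃ < 2 * m := by
    rcases hcond with ⟨-, h⟩ | ⟨-, h⟩
    · refine inf'_mul_bounds (k₀ := 1) (k₁ := 2) (by decide) hα₂pos
        (by simp only [hL]; exact h.1.symm) (by simp only [hL]; exact h₁₄) ?_ ?_ _ <;>
      · simp only [hL, Fin.forall_fin_succ]
        simp
        grind
    · refine inf'_mul_bounds (k₀ := 3) (k₁ := 2) (by decide) hα₂pos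
        (by simp only [hL]; exact h.1.symm) (by simp only [hL]; exact h₁₄) ?_ ?_ _ <;>
      · simp only [hL, Fin.forall_fin_succ]
        simp
        grind
  rw [← hα₁] at hα₁D
  generalize Metric.diam T = D at *
  have hDpos : 0 < D := hα₁pos.trans_le hα₁D
  have hprod : 0 < α₂ * α₃ := mul_pos hα₂pos hα₃pos
  constructor
  · have h : D * m / 2 < α₁ * α₂ * α₃ := by nlinarith
    calc _ = D * m / 2 * (D / (volume T).toReal) := by ring
      _ < α₁ * α₂ * α₃ * (D / (volume T).toReal) := by gcongr
      _ = _ := by ring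
  · have h : α₁ * α₂ * α₃ < 2 * (D * m) := by nlinarith
    calc _ = α₁ * α₂ * α₃ * (D / (volume T).toReal) := by ring
      _ < 2 * (D * m) * (D / (volume T).toReal) := by gcongr
      _ = _ := by ring
end
end

section
/- There exist constants c₁, c₂ > 0 such that for every nondegenerate triangle T₀ ⊂ ℝ² one has c₁·R₂ ≤ H_{T₀} ≤ c₂·R₂, where R₂ is the circumradius of T₀ and H_{T₀} := (h_{T₀}²/|T₀|)·min_{1≤i≤3}|L_i|, with h_{T₀} := diam(T₀), |T₀| the two-dimensional Lebesgue measure of T₀, and L₁, L₂, L₃ the three edges of T₀. -/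
open MeasureTheory

noncomputable section

/-- The right isosceles triangle with vertices `0`, `e₀`, `e₁`. -/
def referenceTriangle : Set (EuclideanSpace ℝ (Fin 2)) :=
  convexHull ℝ {0, !₂[1, 0], !₂[0, 1]}

lemma volume_referenceTriangle_ne_top : volume referenceTriangle ≠ ⊤ := by
  have h : Bornology.IsBounded referenceTriangle :=
    isBounded_convexHull.2 (Set.toFinite _).isBounded
  exact h.measure_lt_top.ne

lemma volume_referenceTriangle_pos : 0 < volume referenceTriangle := by
  have hcont : ∀ i, Continuous fun x : EuclideanSpace ℝ (Fin 2) => x i := fun i => by fun_prop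
  have hopen : IsOpen {x : EuclideanSpace ℝ (Fin 2) | 0 < x 0 ∧ 0 < x 1 ∧ x 0 + x 1 < 1} := by
    exact (isOpen_lt continuous_const (hcont 0)).inter
      ((isOpen_lt continuous_const (hcont 1)).inter
        (isOpen_lt ((hcont 0).add (hcont 1)) continuous_const))
  refine (hopen.measure_pos volume ⟨!₂[1 / 4, 1 / 4], by norm_num⟩).trans_le (measure_mono ?_)
  rintro x ⟨h0, h1, h2⟩
  have hconv : Convex ℝ referenceTriangle := convex_convexHull ℝ _
  have hmem : ∀ y ∈ ({0, !₂[1, 0], !₂[0, 1]} : Set (EuclideanSpace ℝ (Fin 2))),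
      y ∈ referenceTriangle := fun y hy => subset_convexHull ℝ _ hy
  have key := hconv.sum_mem (t := Finset.univ) (w := ![1 - x 0 - x 1, x 0, x 1])
    (z := ![0, !₂[1, 0], !₂[0, 1]])
    (by intro i _; fin_cases i <;> simp <;> linarith)
    (by simp [Fin.sum_univ_three]; ring)
    (by intro i _; fin_cases i <;> exact hmem _ (by simp))
  convert key using 1
  ext i
  fin_cases i <;> simp [Fin.sum_univ_three]

open scoped Pointwise in
/-- The volume of a triangle is proportional to the absolute value of the determinant of two of
its edge vectors. -/
lemma volume_convexHull_triple (p q r : EuclideanSpace ℝ (Fin 2)) :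
    volume (convexHull ℝ {p, q, r}) =
      ENNReal.ofReal |(q 0 - p 0) * (r 1 - p 1) - (q 1 - p 1) * (r 0 - p 0)| *
        volume referenceTriangle := by
  let A : Matrix (Fin 2) (Fin 2) ℝ := !![q 0 - p 0, r 0 - p 0; q 1 - p 1, r 1 - p 1]
  let b := (EuclideanSpace.basisFun (Fin 2) ℝ).toBasis
  let L : EuclideanSpace ℝ (Fin 2) →ₗ[ℝ] EuclideanSpace ℝ (Fin 2) := Matrix.toLin b b A
  have hL : ∀ x i, L x i = A.mulVec x i := fun x i =>
    congrFun (Matrix.repr_toLin b b A x) i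
  have hdet : LinearMap.det L =
      (q 0 - p 0) * (r 1 - p 1) - (q 1 - p 1) * (r 0 - p 0) := by
    rw [LinearMap.det_toLin, Matrix.det_fin_two_of]
    ring
  have himage : convexHull ℝ {p, q, r} = p +ᵥ (L '' referenceTriangle) := by
    rw [referenceTriangle, L.image_convexHull, ← convexHull_vadd]
    congr 1
    have h1 : p + L !₂[1, 0] = q := by
      ext i; fin_cases i <;> simp [hL, A]
    have h2 : p + L !₂[0, 1] = r := by
      ext i; fin_cases i <;> simp [hL, A]
    simp only [Set.image_insert_eq, Set.image_singleton, ← Set.image_vadd, vadd_eq_add, map_zero,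
      add_zero, h1, h2]
  rw [himage, measure_vadd, Measure.addHaar_image_linearMap, hdet]

/-- In a triangle, the product of the side lengths is `2 * R * |D|`, where `D` is the determinant
of two of the edge vectors and `R` is the distance to a point equidistant from the vertices. -/
lemma dist_mul_dist_mul_dist_eq_of_equidistant {p q r o : EuclideanSpace ℝ (Fin 2)} {R : ℝ}
    (hp : dist p o = R) (hq : dist q o = R) (hr : dist r o = R) :
    dist p q * dist p r * dist q r =
      2 * R * |(q 0 - p 0) * (r 1 - p 1) - (q 1 - p 1) * (r 0 - p 0)| := by
  have hR : 0 ≤ R := hp ▸ dist_nonneg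
  have hsq : ∀ x y : EuclideanSpace ℝ (Fin 2),
      dist x y ^ 2 = (x 0 - y 0) ^ 2 + (x 1 - y 1) ^ 2 := fun x y => by
    rw [EuclideanSpace.dist_eq, Real.sq_sqrt (by positivity)]
    simp [Fin.sum_univ_two, Real.dist_eq, sq_abs]
  refine (sq_eq_sq₀ (by positivity) (by positivity)).1 ?_
  simp only [mul_pow, sq_abs, hsq]
  have ep := hsq p o
  have eq := hsq q o
  have er := hsq r o
  rw [hp] at ep
  rw [hq] at eq
  rw [hr] at er
  generalize p 0 = p0 at *
  generalize p 1 = p1 at *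
  generalize q 0 = q0 at *
  generalize q 1 = q1 at *
  generalize r 0 = r0 at *
  generalize r 1 = r1 at *
  generalize o 0 = o0 at *
  generalize o 1 = o1 at *
  have hu : 2 * ((o0 - p0) * (q0 - p0) + (o1 - p1) * (q1 - p1))
      = (q0 - p0) ^ 2 + (q1 - p1) ^ 2 := by linear_combination eq - ep
  have hv : 2 * ((o0 - p0) * (r0 - p0) + (o1 - p1) * (r1 - p1))
      = (r0 - p0) ^ 2 + (r1 - p1) ^ 2 := by linear_combination er - ep
  have hx : 2 * (o0 - p0) * ((q0 - p0) * (r1 - p1) - (q1 - p1) * (r0 - p0)) =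
      ((q0 - p0) ^ 2 + (q1 - p1) ^ 2) * (r1 - p1)
        - ((r0 - p0) ^ 2 + (r1 - p1) ^ 2) * (q1 - p1) := by
    linear_combination (r1 - p1) * hu - (q1 - p1) * hv
  have hy : 2 * (o1 - p1) * ((q0 - p0) * (r1 - p1) - (q1 - p1) * (r0 - p0)) =
      ((r0 - p0) ^ 2 + (r1 - p1) ^ 2) * (q0 - p0)
        - ((q0 - p0) ^ 2 + (q1 - p1) ^ 2) * (r0 - p0) := by
    linear_combination (q0 - p0) * hv - (r0 - p0) * hu
  have hx2 := congrArg (· ^ 2) hx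
  have hy2 := congrArg (· ^ 2) hy
  rw [ep]
  linear_combination -hx2 - hy2

/-- If `a`, `b`, `c` satisfy the triangle inequalities, then the square of the largest one times
the smallest one is comparable to the product of all three. -/
lemma mul_mul_le_max_sq_mul_min {a b c : ℝ} (ha : 0 ≤ a) (hb : 0 ≤ b) (hc : 0 ≤ c)
    (h₁ : a ≤ b + c) (h₂ : b ≤ a + c) (h₃ : c ≤ a + b) :
    a * b * c ≤ max (max a b) c ^ 2 * min (min a b) c ∧
      max (max a b) c ^ 2 * min (min a b) c ≤ 2 * (a * b * c) := by
  have key : ∀ x y z : ℝ, 0 ≤ x → x ≤ y → y ≤ z → z ≤ x + y →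
      x * y * z ≤ z ^ 2 * x ∧ z ^ 2 * x ≤ 2 * (x * y * z) := fun x y z hx hxy hyz h => by
    have hxz : 0 ≤ x * z := by nlinarith
    constructor <;> nlinarith
  rcases le_total a b with hab | hab <;> rcases le_total b c with hbc | hbc <;>
    rcases le_total a c with hac | hac
  all_goals
    simp only [hab, hbc, hac, max_eq_left, max_eq_right, min_eq_left, min_eq_right]
    first
    | have := key a b c ha hab hbc h₃; constructor <;> linarith
    | have := key a c b ha hac hbc (by linarith); constructor <;> linarith
    | have := key b a c hb hab hac (by linarith); constructor <;> linarith
    | have := key b c a hb hbc hac (by linarith); constructor <;> linarith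
    | have := key c a b hc hac hab (by linarith); constructor <;> linarith
    | have := key c b a hc hbc hab (by linarith); constructor <;> linarith
    | obtain rfl : a = b := by linarith
      obtain rfl : a = c := by linarith
      have := key a a a ha le_rfl le_rfl (by linarith)
      constructor <;> linarith

/-- In dimension two, the parameter `H_{T₀}` is equivalent to the circumradius `R₂` of the
triangle `T₀`. -/
theorem stmt_2 :
    ∃ c₁ > (0 : ℝ), ∃ c₂ > (0 : ℝ),
      ∀ S : Affine.Simplex ℝ (EuclideanSpace ℝ (Fin 2)) 2,
        c₁ * S.circumradius ≤
          (Metric.diam (convexHull ℝ (Set.range S.points))) ^ 2 /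
              (volume (convexHull ℝ (Set.range S.points))).toReal *
            min (min (dist (S.points 0) (S.points 1)) (dist (S.points 0) (S.points 2)))
              (dist (S.points 1) (S.points 2)) ∧
        (Metric.diam (convexHull ℝ (Set.range S.points))) ^ 2 /
              (volume (convexHull ℝ (Set.range S.points))).toReal *
            min (min (dist (S.points 0) (S.points 1)) (dist (S.points 0) (S.points 2)))
              (dist (S.points 1) (S.points 2))
          ≤ c₂ * S.circumradius := by
  have hκ : 0 < (volume referenceTriangle).toReal :=
    ENNReal.toReal_pos volume_referenceTriangle_pos.ne' volume_referenceTriangle_ne_top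
  refine ⟨2 / (volume referenceTriangle).toReal, by positivity,
    4 / (volume referenceTriangle).toReal, by positivity, fun S => ?_⟩
  have hrange : Set.range S.points = {S.points 0, S.points 1, S.points 2} := by
    ext x
    simp [Fin.exists_fin_succ, eq_comm (a := x)]
  have hinj := S.independent.injective
  have h01 : 0 < dist (S.points 0) (S.points 1) := dist_pos.2 (hinj.ne (by decide))
  have h02 : 0 < dist (S.points 0) (S.points 2) := dist_pos.2 (hinj.ne (by decide))
  have h12 : 0 < dist (S.points 1) (S.points 2) := dist_pos.2 (hinj.ne (by decide))
  have hprod := dist_mul_dist_mul_dist_eq_of_equidistant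
    (S.dist_circumcenter_eq_circumradius 0) (S.dist_circumcenter_eq_circumradius 1)
    (S.dist_circumcenter_eq_circumradius 2)
  have hineq := mul_mul_le_max_sq_mul_min h01.le h02.le h12.le
    (by rw [dist_comm (S.points 1)]; exact dist_triangle _ _ _)
    (dist_triangle _ _ _)
    (by rw [dist_comm (S.points 0)]; exact dist_triangle _ _ _)
  rw [hrange, volume_convexHull_triple, convexHull_diam, Metric.diam_triple, ENNReal.toReal_mul,
    ENNReal.toReal_ofReal (abs_nonneg _)]
  rw [hprod] at hineq
  have hD : 0 < |(S.points 1 0 - S.points 0 0) * (S.points 2 1 - S.points 0 1) -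
      (S.points 1 1 - S.points 0 1) * (S.points 2 0 - S.points 0 0)| := by
    refine (abs_nonneg _).lt_of_ne' fun h => ?_
    rw [h, mul_zero] at hprod
    exact (mul_pos (mul_pos h01 h02) h12).ne' hprod
  rw [div_mul_eq_mul_div, div_mul_eq_mul_div, div_mul_eq_mul_div, le_div_iff₀ (by positivity),
    div_le_div_iff₀ (by positivity) hκ, div_mul_eq_mul_div, div_le_iff₀ hκ]
  constructor
  · nlinarith [mul_le_mul_of_nonneg_right hineq.1 hκ.le]
  · nlinarith [mul_le_mul_of_nonneg_right hineq.2 hκ.le]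
end
end

section
/- Let s₁, t₁, s₂₁, s₂₂, t₂ ∈ ℝ with s₁² + t₁² = 1, t₁ > 0, s₂₁² + s₂₂² + t₂² = 1, t₂ > 0, and let Ã be either of the 3×3 matrices Ã₁ = [[1, s₁, s₂₁],[0, t₁, s₂₂],[0, 0, t₂]] or Ã₂ = [[1, −s₁, s₂₁],[0, t₁, s₂₂],[0, 0, t₂]] (both invertible). Then ‖Ã‖₂ ≤ 2, and for all α₁, α₂, α₃ > 0, ‖Ã‖₂·‖Ã⁻¹‖₂ ≤ (2/3)·α₁α₂α₃/|T| (= 4/(t₁t₂)), where T ⊂ ℝ³ is the tetrahedron with vertices x₁ = (0,0,0), x₂ = (α₁,0,0), x₄ = (α₃s₂₁, α₃s₂₂, α₃t₂), and x₃ = (α₂s₁, α₂t₁, 0) if Ã = Ã₁ or x₃ = (α₁ − α₂s₁, α₂t₁, 0) if Ã = Ã₂, and |T| is its three-dimensional Lebesgue measure. -/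
open MeasureTheory

noncomputable section

/-- The operator norm of a matrix induced by the Euclidean norms. -/
def opNorm2 {d : ℕ} (A : Matrix (Fin d) (Fin d) ℝ) : ℝ :=
  ‖LinearMap.toContinuousLinearMap (Matrix.toEuclideanLin A)‖

/-- The Euclidean operator norm is at most the Frobenius norm. -/
lemma opNorm2_le_of_sum_sq_le {d : ℕ} (A : Matrix (Fin d) (Fin d) ℝ) {c : ℝ} (hc : 0 ≤ c)
    (h : ∑ i, ∑ j, A i j ^ 2 ≤ c ^ 2) : opNorm2 A ≤ c := by
  refine ContinuousLinearMap.opNorm_le_bound _ hc fun x => ?_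
  refine le_of_sq_le_sq ?_ (by positivity)
  rw [mul_pow, EuclideanSpace.norm_sq_eq, EuclideanSpace.norm_sq_eq]
  simp only [Real.norm_eq_abs, sq_abs]
  calc ∑ i, (Matrix.toEuclideanLin A x) i ^ 2
      = ∑ i, (∑ j, A i j * x j) ^ 2 := rfl
    _ ≤ ∑ i, (∑ j, A i j ^ 2) * ∑ j, x j ^ 2 :=
        Finset.sum_le_sum fun i _ => Finset.sum_mul_sq_le_sq_mul_sq _ _ _
    _ = (∑ i, ∑ j, A i j ^ 2) * ∑ j, x j ^ 2 := by rw [Finset.sum_mul]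
    _ ≤ c ^ 2 * ∑ j, x j ^ 2 := by gcongr

/-- The simplex cut off the positive orthant by the hyperplane `∑ i, x i = r`. -/
def cornerSimplex (n : ℕ) (r : ℝ) : Set (Fin n → ℝ) :=
  {x | (∀ i, 0 ≤ x i) ∧ ∑ i, x i ≤ r}

lemma isClosed_cornerSimplex (n : ℕ) (r : ℝ) : IsClosed (cornerSimplex n r) := by
  refine IsClosed.and ?_ (isClosed_le (by fun_prop) continuous_const)
  simp only [Set.ofPred_forall]
  exact isClosed_iInter fun i => isClosed_le continuous_const (by fun_prop)

lemma cornerSimplex_eq_empty {n : ℕ} {r : ℝ} (hr : r < 0) : cornerSimplex n r = ∅ :=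
  Set.eq_empty_of_forall_notMem fun _ hx =>
    (hx.2.trans_lt hr).not_ge (Finset.sum_nonneg fun i _ => hx.1 i)

lemma volume_cornerSimplex (n : ℕ) {r : ℝ} (hr : 0 ≤ r) :
    volume (cornerSimplex n r) = ENNReal.ofReal (r ^ n / n.factorial) := by
  induction n generalizing r with
  | zero =>
    have : cornerSimplex 0 r = Set.univ := by
      ext x; simp [cornerSimplex, hr]
    rw [this, volume_pi, Measure.pi_univ]
    simp
  | succ n ih =>
    have hslice (a : ℝ) : volume (Prod.mk a ⁻¹'
        ((MeasurableEquiv.piFinSuccAbove (fun _ : Fin (n + 1) => ℝ) 0).symm ⁻¹'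
          cornerSimplex (n + 1) r)) =
        (Set.Icc 0 r).indicator (fun a => ENNReal.ofReal ((r - a) ^ n / n.factorial)) a := by
      have hset : Prod.mk a ⁻¹'
          ((MeasurableEquiv.piFinSuccAbove (fun _ : Fin (n + 1) => ℝ) 0).symm ⁻¹'
            cornerSimplex (n + 1) r) = {y | 0 ≤ a ∧ y ∈ cornerSimplex n (r - a)} := by
        ext y
        simp [cornerSimplex, MeasurableEquiv.piFinSuccAbove, Fin.forall_fin_succ,
          Fin.sum_univ_succ, Fin.insertNthEquiv, le_sub_iff_add_le', and_assoc]
      rw [hset]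
      by_cases ha : a ∈ Set.Icc 0 r
      · rw [Set.indicator_of_mem ha, ← ih (sub_nonneg.2 ha.2)]
        simp [ha.1]
      · rw [Set.indicator_of_notMem ha]
        by_cases h0 : 0 ≤ a
        · have : r - a < 0 := by
            rw [sub_neg]; by_contra! h; exact ha ⟨h0, h⟩
          simp [cornerSimplex_eq_empty this]
        · simp [h0]
    rw [← (volume_preserving_piFinSuccAbove (fun _ : Fin (n + 1) => ℝ) 0).symm.measure_preimage
      (isClosed_cornerSimplex _ _).measurableSet.nullMeasurableSet, Measure.volume_eq_prod,
      Measure.prod_apply ((MeasurableEquiv.measurable _)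
        (isClosed_cornerSimplex _ _).measurableSet)]
    simp_rw [hslice]
    rw [lintegral_indicator measurableSet_Icc, ← ofReal_integral_eq_lintegral_ofReal]
    · congr 1
      rw [integral_Icc_eq_integral_Ioc, ← intervalIntegral.integral_of_le hr,
        intervalIntegral.integral_div,
        intervalIntegral.integral_comp_sub_left (fun x => x ^ n) r, integral_pow]
      rw [Nat.factorial_succ]
      push_cast
      field_simp
      simp
    · exact (Continuous.continuousOn (by fun_prop)).integrableOn_Icc
    · filter_upwards [ae_restrict_mem measurableSet_Icc] with a ha
      have := sub_nonneg.2 ha.2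
      simp only [Pi.zero_apply]
      positivity

lemma convexHull_insert_zero_range {n : ℕ} {E : Type*} [AddCommGroup E] [Module ℝ E]
    (v : Fin n → E) :
    convexHull ℝ (insert 0 (Set.range v)) =
      Fintype.linearCombination ℝ v '' cornerSimplex n 1 := by
  apply Set.Subset.antisymm
  · refine convexHull_min ?_ (Convex.linear_image ?_ _)
    · rintro _ (rfl | ⟨i, rfl⟩)
      · exact ⟨0, by simp [cornerSimplex], map_zero _⟩
      · refine ⟨Pi.single i 1, ⟨fun j => ?_, by simp⟩, by simp⟩
        by_cases h : j = i
        · subst h; simp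
        · simp [h]
    · intro x hx y hy a b ha hb hab
      refine ⟨fun i => ?_, ?_⟩
      · have := hx.1 i
        have := hy.1 i
        simp only [Pi.add_apply, Pi.smul_apply, smul_eq_mul]
        positivity
      · simp only [Pi.add_apply, Pi.smul_apply, smul_eq_mul, Finset.sum_add_distrib,
          ← Finset.mul_sum]
        nlinarith [hx.2, hy.2]
  · rintro _ ⟨x, hx, rfl⟩
    have := (convex_convexHull ℝ (insert 0 (Set.range v))).sum_mem
      (t := Finset.univ) (w := Fin.cons (1 - ∑ i, x i) x) (z := (Fin.cons 0 v : Fin (n + 1) → E))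
      (fun i _ => by
        cases i using Fin.cases with
        | zero => simpa using hx.2
        | succ i => simpa using hx.1 i)
      (by simp [Fin.sum_univ_succ])
      (fun i _ => by
        apply subset_convexHull
        cases i using Fin.cases <;> simp)
    simpa [Fin.sum_univ_succ, Fintype.linearCombination_apply] using this

/-- The volume of a simplex with one vertex at the origin. -/
lemma volume_convexHull_insert_zero_range {n : ℕ} (v : Fin n → EuclideanSpace ℝ (Fin n)) :
    volume (convexHull ℝ (insert 0 (Set.range v))) =
      ENNReal.ofReal (|(Matrix.of fun i j => v i j).det| / n.factorial) := by
  set M : Matrix (Fin n) (Fin n) ℝ := Matrix.of fun i j => v i j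
  have himg : convexHull ℝ (insert 0 (Set.range v)) =
      WithLp.ofLp ⁻¹' (Matrix.toLin' M.transpose '' cornerSimplex n 1) := by
    have hlin (x : Fin n → ℝ) : (Fintype.linearCombination ℝ v x) =
        WithLp.toLp 2 (Matrix.toLin' M.transpose x) := by
      ext j
      simp [Fintype.linearCombination_apply, Matrix.mulVec, dotProduct, M, mul_comm]
    rw [convexHull_insert_zero_range]
    ext y
    simp only [Set.mem_image, Set.mem_preimage, hlin]
    refine exists_congr fun x => and_congr_right fun _ => ⟨?_, ?_⟩
    · rintro rfl; rfl
    · intro h; rw [h]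
  have hconv : IsCompact (Matrix.toLin' M.transpose '' cornerSimplex n 1) := by
    refine IsCompact.image ?_ (LinearMap.continuous_of_finiteDimensional _)
    refine (isCompact_Icc (a := (0 : Fin n → ℝ)) (b := 1)).of_isClosed_subset
      (isClosed_cornerSimplex _ _) fun x hx => ⟨hx.1, fun i => ?_⟩
    exact (Finset.single_le_sum (fun j _ => hx.1 j) (Finset.mem_univ i)).trans hx.2
  rw [himg, (PiLp.volume_preserving_ofLp (Fin n)).measure_preimage
    hconv.measurableSet.nullMeasurableSet, Measure.addHaar_image_linearMap,
    volume_cornerSimplex n zero_le_one, LinearMap.det_toLin', Matrix.det_transpose,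
    ← ENNReal.ofReal_mul (abs_nonneg _), one_pow, mul_one_div]

/-- Euclidean condition number bound for the 3×3 matrices
`Ã₁ = [[1, s₁, s₂₁],[0, t₁, s₂₂],[0, 0, t₂]]` and `Ã₂ = [[1, −s₁, s₂₁],[0, t₁, s₂₂],[0, 0, t₂]]`:
`‖Ã‖₂ ≤ 2` and `‖Ã‖₂‖Ã⁻¹‖₂ ≤ (2/3)·α₁α₂α₃/|T| (= 4/(t₁t₂))`. -/
theorem stmt_6
    (s₁ t₁ s₂₁ s₂₂ t₂ : ℝ)
    (h₁ : s₁ ^ 2 + t₁ ^ 2 = 1) (ht₁ : 0 < t₁)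
    (h₂ : s₂₁ ^ 2 + s₂₂ ^ 2 + t₂ ^ 2 = 1) (ht₂ : 0 < t₂)
    -- `σ = true` corresponds to `Ã₁`, `σ = false` to `Ã₂`
    (σ : Bool)
    (At : Matrix (Fin 3) (Fin 3) ℝ)
    (hAt : At = if σ then !![1, s₁, s₂₁; 0, t₁, s₂₂; 0, 0, t₂]
      else !![1, -s₁, s₂₁; 0, t₁, s₂₂; 0, 0, t₂]) :
    IsUnit At.det ∧
    opNorm2 At ≤ 2 ∧
    ∀ α₁ α₂ α₃ : ℝ, 0 < α₁ → 0 < α₂ → 0 < α₃ →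
      ∀ x₁ x₂ x₃ x₄ : EuclideanSpace ℝ (Fin 3),
        x₁ = 0 →
        (∀ j : Fin 3, x₂ j = if (j : ℕ) = 0 then α₁ else 0) →
        (∀ j : Fin 3, x₃ j =
          if (j : ℕ) = 0 then (if σ then α₂ * s₁ else α₁ - α₂ * s₁)
          else if (j : ℕ) = 1 then α₂ * t₁ else 0) →
        (∀ j : Fin 3, x₄ j =
          if (j : ℕ) = 0 then α₃ * s₂₁ else if (j : ℕ) = 1 then α₃ * s₂₂ else α₃ * t₂) →
        opNorm2 At * opNorm2 At⁻¹ ≤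
          (2 / 3) * (α₁ * α₂ * α₃) / (volume (convexHull ℝ {x₁, x₂, x₃, x₄})).toReal ∧
        (2 / 3) * (α₁ * α₂ * α₃) / (volume (convexHull ℝ {x₁, x₂, x₃, x₄})).toReal =
          4 / (t₁ * t₂) := by
  obtain ⟨s, hs, hss⟩ : ∃ s : ℝ, s ^ 2 = s₁ ^ 2 ∧
      At = !![1, s, s₂₁; 0, t₁, s₂₂; 0, 0, t₂] := by
    cases σ
    · exact ⟨-s₁, by ring, by simpa using hAt⟩
    · exact ⟨s₁, rfl, by simpa using hAt⟩
  have hD : 0 < t₁ * t₂ := mul_pos ht₁ ht₂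
  have hdet : At.det = t₁ * t₂ := by
    rw [hss]; simp [Matrix.det_fin_three]
  have hunit : IsUnit At.det := by rw [hdet]; exact hD.ne'.isUnit
  have h3 : √3 ^ 2 = 3 := Real.sq_sqrt (by norm_num)
  have hnorm : opNorm2 At ≤ √3 := by
    apply opNorm2_le_of_sum_sq_le _ (Real.sqrt_nonneg _)
    rw [hss]
    simp [Fin.sum_univ_three]
    nlinarith
  have hinv : At⁻¹ = !![1, -s / t₁, (s * s₂₂ - s₂₁ * t₁) / (t₁ * t₂);
      0, 1 / t₁, -s₂₂ / (t₁ * t₂); 0, 0, 1 / t₂] := by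
    apply Matrix.inv_eq_right_inv
    rw [hss]
    ext i j
    fin_cases i <;> fin_cases j <;> simp [Matrix.mul_apply, Fin.sum_univ_three] <;>
      field_simp <;> ring
  have hnorm_inv : opNorm2 At⁻¹ ≤ √3 / (t₁ * t₂) := by
    apply opNorm2_le_of_sum_sq_le _ (by positivity)
    rw [div_pow, h3, le_div_iff₀ (by positivity), hinv]
    have hsum : (∑ i, ∑ j, (!![1, -s / t₁, (s * s₂₂ - s₂₁ * t₁) / (t₁ * t₂);
        0, 1 / t₁, -s₂₂ / (t₁ * t₂); 0, 0, 1 / t₂] : Matrix (Fin 3) (Fin 3) ℝ) i j ^ 2) *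
        (t₁ * t₂) ^ 2 = t₁ ^ 2 * t₂ ^ 2 + s ^ 2 * t₂ ^ 2 + (s * s₂₂ - s₂₁ * t₁) ^ 2
          + t₂ ^ 2 + s₂₂ ^ 2 + t₁ ^ 2 := by
      simp [Fin.sum_univ_three]
      field_simp
      ring
    rw [hsum]
    have hcs : (s * s₂₂ - s₂₁ * t₁) ^ 2 ≤ (s ^ 2 + t₁ ^ 2) * (s₂₂ ^ 2 + s₂₁ ^ 2) := by
      nlinarith [sq_nonneg (s * s₂₁ + s₂₂ * t₁)]
    have hst : s ^ 2 + t₁ ^ 2 = 1 := by rw [hs, h₁]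
    have ht : t₁ ^ 2 * t₂ ^ 2 + s ^ 2 * t₂ ^ 2 = t₂ ^ 2 := by
      rw [← add_mul, add_comm, hst, one_mul]
    rw [hst, one_mul] at hcs
    nlinarith [sq_nonneg s, sq_nonneg s₂₁]
  refine ⟨hunit, hnorm.trans (by nlinarith [Real.sqrt_nonneg 3]), ?_⟩
  intro α₁ α₂ α₃ hα₁ hα₂ hα₃ x₁ x₂ x₃ x₄ hx₁ hx₂ hx₃ hx₄
  have hset : ({x₁, x₂, x₃, x₄} : Set (EuclideanSpace ℝ (Fin 3))) =
      insert 0 (Set.range ![x₂, x₃, x₄]) := by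
    ext y
    simp only [hx₁, Set.mem_insert_iff, Set.mem_singleton_iff, Matrix.range_cons,
      Matrix.range_empty, Set.union_empty, Set.mem_union]
  have hdetv : (Matrix.of fun i j => (![x₂, x₃, x₄] : Fin 3 → EuclideanSpace ℝ (Fin 3)) i j).det =
      α₁ * α₂ * α₃ * (t₁ * t₂) := by
    simp [Matrix.det_fin_three, hx₂, hx₃, hx₄]
    ring
  have hvol : (volume (convexHull ℝ {x₁, x₂, x₃, x₄})).toReal =
      α₁ * α₂ * α₃ * (t₁ * t₂) / 6 := by
    rw [hset, volume_convexHull_insert_zero_range, hdetv, abs_of_pos (by positivity),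
      ENNReal.toReal_ofReal (by positivity)]
    norm_num [Nat.factorial]
  have heq : (2 / 3) * (α₁ * α₂ * α₃) / (volume (convexHull ℝ {x₁, x₂, x₃, x₄})).toReal =
      4 / (t₁ * t₂) := by
    rw [hvol]; field_simp; norm_num
  refine ⟨?_, heq⟩
  rw [heq]
  calc opNorm2 At * opNorm2 At⁻¹ ≤ √3 * (√3 / (t₁ * t₂)) :=
        mul_le_mul hnorm hnorm_inv (norm_nonneg _) (Real.sqrt_nonneg _)
    _ = 3 / (t₁ * t₂) := by rw [mul_div_assoc', ← sq, h3]
    _ ≤ 4 / (t₁ * t₂) := by gcongr; norm_num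
end
end
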